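/- arXiv:2111.15445 — 2 statements merged into one kernel-verified Lean document; each statement's English description precedes it below -/
import Mathlib

section
/- Let ε > 0. The Erdős–Rényi random graph G(n,p) with vertex set V, |V| = n, and edge probability p ≥ ε has the following property with probability tending to 1 as n → ∞: for every set S ⊆ V with |S| ≥ εn there exists a set X_S ⊆ V∖S of size at most 4ε⁻³(ln ε⁻¹ + 2) such that every vertex v ∈ (V∖S)∖X_S satisfies | |N(v) ∩ S| − p|S| | ≤ εp|S|. -/
open MeasureTheory Filter

namespace ErdosRenyi

/-- Bernoulli measure on `Bool` with success probability `p` (clamped to `[0,1]`). -/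
noncomputable def bern (p : ℝ) : Measure Bool :=
  (PMF.bernoulli (min (Real.toNNReal p) 1) (min_le_right _ _)).toMeasure

instance (p : ℝ) : IsProbabilityMeasure (bern p) := by
  unfold bern; infer_instance

/-- The Erdős–Rényi random graph on `Fin n` determined by the family of
independent Bernoulli bits `ω`: distinct vertices `v, w` are adjacent iff the
bit associated to the unordered pair `{v, w}` is `true`. -/
def erGraph (n : ℕ) (ω : Fin n → Fin n → Bool) : SimpleGraph (Fin n) where
  Adj v w := v ≠ w ∧ (if v ≤ w then ω v w else ω w v) = true
  symm := by
    constructor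
    intro v w ⟨hne, h⟩
    refine ⟨hne.symm, ?_⟩
    by_cases hvw : v ≤ w
    · have hwv : ¬ w ≤ v := fun h2 => hne (le_antisymm hvw h2)
      rw [if_pos hvw] at h; rw [if_neg hwv]; exact h
    · have hwv : w ≤ v := le_of_not_ge hvw
      rw [if_neg hvw] at h; rw [if_pos hwv]; exact h
  loopless := ⟨fun v h => h.1 rfl⟩

/-- The product measure making all the edge indicator bits independent
Bernoulli(`p`) random variables; under this measure `erGraph n ω` is the
Erdős–Rényi random graph `G(n, p)`. -/
noncomputable def erMeasure (n : ℕ) (p : ℝ) : Measure (Fin n → Fin n → Bool) :=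
  Measure.pi fun _ => Measure.pi fun _ => bern p

instance (n : ℕ) (p : ℝ) : IsProbabilityMeasure (erMeasure n p) := by
  unfold erMeasure; infer_instance

/-- The moment generating function of a Bernoulli bit, bounded to second order. -/
lemma integral_bern_exp_le {p : ℝ} (hp0 : 0 ≤ p) (hp1 : p ≤ 1) {c : ℝ} (hc : |c| ≤ 1) :
    ∫ b, Real.exp (c * cond b 1 0) ∂(bern p) ≤ Real.exp (p * (c + c ^ 2)) := by
  have hval : ∫ b, Real.exp (c * cond b 1 0) ∂(bern p) = p * Real.exp c + (1 - p) := by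
    have hmin : min p.toNNReal 1 = p.toNNReal := min_eq_left (by simpa using hp1)
    have hcoe : ((1 - p.toNNReal : NNReal) : ℝ) = 1 - p := by
      rw [NNReal.coe_sub (by simpa using hp1)]; simp [hp0]
    simp [bern, PMF.integral_eq_sum, PMF.bernoulli_apply, hmin, hcoe, hp0]
  have hexp := (abs_le.1 (Real.abs_exp_sub_one_sub_id_le hc)).2
  have hmul := mul_le_mul_of_nonneg_left hexp hp0
  rw [hval]
  linarith [Real.add_one_le_exp (p * (c + c ^ 2))]

/-- Exponential moment of a weighted sum of the independent bits. -/
lemma integral_exp_sum_le (n : ℕ) {p : ℝ} (hp0 : 0 ≤ p) (hp1 : p ≤ 1)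
    (c : Fin n → Fin n → ℝ) (hc : ∀ i j, |c i j| ≤ 1) :
    ∫ ω, Real.exp (∑ i, ∑ j, c i j * cond (ω i j) 1 0) ∂(erMeasure n p)
      ≤ Real.exp (p * ∑ i, ∑ j, (c i j + c i j ^ 2)) := by
  simp_rw [Real.exp_sum, Finset.mul_sum, Real.exp_sum, erMeasure]
  rw [integral_fintype_prod_eq_prod
    (f := fun i (x : Fin n → Bool) => ∏ j, Real.exp (c i j * cond (x j) 1 0))]
  refine Finset.prod_le_prod
    (fun i _ => integral_nonneg fun x => Finset.prod_nonneg fun j _ => (Real.exp_pos _).le)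
    fun i _ => ?_
  rw [integral_fintype_prod_eq_prod (f := fun j (b : Bool) => Real.exp (c i j * cond b 1 0))]
  exact Finset.prod_le_prod (fun j _ => integral_nonneg fun b => (Real.exp_pos _).le)
    fun j _ => integral_bern_exp_le hp0 hp1 (hc i j)

/-- The coefficient of the bit `(i, j)` in the sum of `σ v` times the number of neighbours of `v`
in `S`, over `v ∈ T`. -/
noncomputable def bitWeight {n : ℕ} (S T : Finset (Fin n)) (σ : Fin n → ℝ) (i j : Fin n) : ℝ :=
  (if i ≤ j ∧ i ∈ T ∧ j ∈ S then σ i else 0) + (if i ≤ j ∧ j ∈ T ∧ i ∈ S then σ j else 0)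

lemma sum_bitWeight_mul {n : ℕ} {S T : Finset (Fin n)} (hST : Disjoint T S) (σ : Fin n → ℝ)
    (x : Fin n → Fin n → ℝ) :
    ∑ i, ∑ j, bitWeight S T σ i j * x i j
      = ∑ v ∈ T, ∑ w ∈ S, σ v * (if v ≤ w then x v w else x w v) := by
  have hswap : ∑ i, ∑ j, (if i ≤ j ∧ j ∈ T ∧ i ∈ S then σ j else 0) * x i j
      = ∑ v, ∑ w, (if w ≤ v ∧ v ∈ T ∧ w ∈ S then σ v else 0) * x w v := Finset.sum_comm
  simp_rw [bitWeight, add_mul, Finset.sum_add_distrib]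
  rw [hswap, ← Finset.sum_add_distrib, ← Finset.sum_subset (Finset.subset_univ T)]
  · refine Finset.sum_congr rfl fun v hv => ?_
    rw [← Finset.sum_add_distrib, ← Finset.sum_subset (Finset.subset_univ S)]
    · refine Finset.sum_congr rfl fun w hw => ?_
      have hne : v ≠ w := fun h => Finset.disjoint_left.1 hST hv (h ▸ hw)
      rcases hne.lt_or_gt with h | h
      · simp [hv, hw, h.le, h.not_ge]
      · simp [hv, hw, h.le, h.not_ge]
    · intro w _ hw
      simp [hw]
  · intro v _ hv
    simp [hv]

lemma bitWeight_sq {n : ℕ} {S T : Finset (Fin n)} (hST : Disjoint T S) (σ : Fin n → ℝ)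
    (i j : Fin n) : bitWeight S T σ i j ^ 2 = bitWeight S T (fun v => σ v ^ 2) i j := by
  have hd : ∀ v, v ∈ T → v ∉ S := fun v hv => Finset.disjoint_left.1 hST hv
  unfold bitWeight
  split_ifs with h₁ h₂ <;> first | exact absurd h₂.2.2 (hd _ h₁.2.1) | simp

lemma abs_bitWeight_le {n : ℕ} {S T : Finset (Fin n)} (hST : Disjoint T S) {σ : Fin n → ℝ}
    (hσ : ∀ v, |σ v| ≤ 1) (i j : Fin n) : |bitWeight S T σ i j| ≤ 1 := by
  have hd : ∀ v, v ∈ T → v ∉ S := fun v hv => Finset.disjoint_left.1 hST hv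
  unfold bitWeight
  split_ifs with h₁ h₂ <;> first | exact absurd h₂.2.2 (hd _ h₁.2.1) | simp [hσ]

lemma ncard_neighborSet_inter {n : ℕ} (ω : Fin n → Fin n → Bool) {S : Finset (Fin n)} {v : Fin n}
    (hv : v ∉ S) :
    (((erGraph n ω).neighborSet v ∩ ↑S).ncard : ℝ)
      = ∑ w ∈ S, if v ≤ w then cond (ω v w) 1 0 else cond (ω w v) 1 0 := by
  have hset : (erGraph n ω).neighborSet v ∩ ↑S
      = ↑(S.filter fun w => (if v ≤ w then ω v w else ω w v) = true) := by
    ext w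
    have hne : w ∈ S → v ≠ w := fun hw h => hv (h ▸ hw)
    simp only [Set.mem_inter_iff, SimpleGraph.mem_neighborSet, erGraph, Finset.coe_filter,
      Set.mem_ofPred_eq, Finset.mem_coe]
    tauto
  rw [hset, Set.ncard_coe_finset, Finset.card_filter]
  push_cast
  refine Finset.sum_congr rfl fun w _ => ?_
  split_ifs <;> simp_all

/-- Joint exponential moment of the degrees into `S` of the vertices of a set `T` disjoint
from `S`. -/
lemma integral_exp_degrees_le {n : ℕ} {p : ℝ} (hp0 : 0 ≤ p) (hp1 : p ≤ 1)
    {S T : Finset (Fin n)} (hST : Disjoint T S) {σ : Fin n → ℝ} (hσ : ∀ v, |σ v| ≤ 1) :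
    ∫ ω, Real.exp (∑ v ∈ T, σ v * (((erGraph n ω).neighborSet v ∩ ↑S).ncard : ℝ))
        ∂(erMeasure n p)
      ≤ Real.exp (∑ v ∈ T, p * S.card * (σ v + σ v ^ 2)) := by
  have hleft : ∀ ω : Fin n → Fin n → Bool,
      ∑ v ∈ T, σ v * (((erGraph n ω).neighborSet v ∩ ↑S).ncard : ℝ)
        = ∑ i, ∑ j, bitWeight S T σ i j * cond (ω i j) 1 0 := fun ω => by
    rw [sum_bitWeight_mul hST]
    refine Finset.sum_congr rfl fun v hv => ?_
    rw [ncard_neighborSet_inter ω (Finset.disjoint_left.1 hST hv), Finset.mul_sum]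
  have hright : ∀ τ : Fin n → ℝ,
      ∑ i, ∑ j, bitWeight S T τ i j = ∑ v ∈ T, S.card * τ v := fun τ => by
    simpa using sum_bitWeight_mul hST τ fun _ _ => 1
  simp_rw [hleft]
  refine (integral_exp_sum_le n hp0 hp1 _ (abs_bitWeight_le hST hσ)).trans_eq ?_
  simp_rw [bitWeight_sq hST, Finset.sum_add_distrib, hright]
  rw [← Finset.sum_add_distrib, Finset.mul_sum]
  congr 1
  exact Finset.sum_congr rfl fun v _ => by ring

/-- The event that the degree of `v` into `S` deviates from its mean by more than a factor `ε`. -/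
def IsDeviant {n : ℕ} (ε p : ℝ) (ω : Fin n → Fin n → Bool) (S : Finset (Fin n)) (v : Fin n) :
    Prop :=
  ε * (p * S.card) < |(((erGraph n ω).neighborSet v ∩ ↑S).ncard : ℝ) - p * S.card|

/-- Chernoff bound for simultaneous deviations with prescribed directions: upwards on `U`,
downwards on `T \ U`. -/
lemma measureReal_signed_deviation_le {n : ℕ} {ε p : ℝ} (hε : 0 ≤ ε) (hε1 : ε ≤ 1) (hp0 : 0 ≤ p)
    (hp1 : p ≤ 1) {S T : Finset (Fin n)} (hST : Disjoint T S) (U : Finset (Fin n)) :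
    (erMeasure n p).real {ω | ∀ v ∈ T, ε * (p * S.card) <
        (if v ∈ U then 1 else -1) *
          ((((erGraph n ω).neighborSet v ∩ ↑S).ncard : ℝ) - p * S.card)}
      ≤ Real.exp (-(T.card * (ε ^ 2 * p / 4)) * S.card) := by
  set σ : Fin n → ℝ := fun v => ε / 2 * (if v ∈ U then 1 else -1) with hσdef
  have hσ : ∀ v, |σ v| ≤ 1 := fun v => by
    rw [hσdef, abs_le]; dsimp only; split_ifs <;> constructor <;> linarith
  have hσsq : ∀ v, σ v ^ 2 = ε ^ 2 / 4 := fun v => by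
    rw [hσdef]; dsimp only; split_ifs <;> ring
  set c : ℝ := ∑ v ∈ T, (σ v * (p * S.card) + ε / 2 * (ε * (p * S.card))) with hc
  set Y : (Fin n → Fin n → Bool) → ℝ :=
    fun ω => ∑ v ∈ T, σ v * (((erGraph n ω).neighborSet v ∩ ↑S).ncard : ℝ)
  have hsub : {ω | ∀ v ∈ T, ε * (p * S.card) <
        (if v ∈ U then 1 else -1) *
          ((((erGraph n ω).neighborSet v ∩ ↑S).ncard : ℝ) - p * S.card)}
      ⊆ {ω | Real.exp c ≤ Real.exp (Y ω)} := fun ω hω => by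
    refine Real.exp_le_exp.2 (Finset.sum_le_sum fun v hv => ?_)
    have := mul_le_mul_of_nonneg_left (hω v hv).le (by linarith : (0 : ℝ) ≤ ε / 2)
    simp only [hσdef]
    linarith
  have hmarkov := mul_meas_ge_le_integral_of_nonneg (μ := erMeasure n p)
    (f := fun ω => Real.exp (Y ω)) (.of_forall fun ω => (Real.exp_pos _).le) .of_finite
    (Real.exp c)
  have hmom := hmarkov.trans (integral_exp_degrees_le hp0 hp1 hST hσ)
  refine (measureReal_mono hsub).trans ?_
  rw [← mul_le_mul_iff_right₀ (Real.exp_pos c)]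
  refine hmom.trans_eq ?_
  rw [← Real.exp_add, hc]
  congr 1
  simp_rw [hσsq, mul_add, Finset.sum_add_distrib, Finset.sum_const, nsmul_eq_mul]
  simp_rw [mul_comm (p * (S.card : ℝ))]
  ring

/-- Chernoff bound for the simultaneous deviation of all vertices of `T`. -/
lemma measureReal_all_deviant_le {n : ℕ} {ε p : ℝ} (hε : 0 ≤ ε) (hε1 : ε ≤ 1) (hp0 : 0 ≤ p)
    (hp1 : p ≤ 1) {S T : Finset (Fin n)} (hST : Disjoint T S) :
    (erMeasure n p).real {ω | ∀ v ∈ T, IsDeviant ε p ω S v}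
      ≤ 2 ^ T.card * Real.exp (-(T.card * (ε ^ 2 * p / 4)) * S.card) := by
  classical
  have hsub : {ω | ∀ v ∈ T, IsDeviant ε p ω S v} ⊆ ⋃ U ∈ T.powerset,
      {ω | ∀ v ∈ T, ε * (p * S.card) < (if v ∈ U then 1 else -1) *
          ((((erGraph n ω).neighborSet v ∩ ↑S).ncard : ℝ) - p * S.card)} := fun ω hω => by
    simp only [Set.mem_iUnion]
    refine ⟨T.filter fun v => 0 ≤ (((erGraph n ω).neighborSet v ∩ ↑S).ncard : ℝ) - p * S.card,
      Finset.mem_powerset.2 (Finset.filter_subset _ _), fun v hv => ?_⟩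
    have h := hω v hv
    unfold IsDeviant at h
    by_cases h0 : 0 ≤ (((erGraph n ω).neighborSet v ∩ ↑S).ncard : ℝ) - p * S.card
    · rw [if_pos (Finset.mem_filter.2 ⟨hv, h0⟩), one_mul]
      rwa [abs_of_nonneg h0] at h
    · rw [if_neg (by simpa [hv] using h0), neg_one_mul]
      rwa [abs_of_neg (not_le.1 h0)] at h
  refine (measureReal_mono hsub (measure_ne_top _ _)).trans ((measureReal_biUnion_finset_le _ _).trans ?_)
  refine (Finset.sum_le_sum fun U _ =>
    measureReal_signed_deviation_le hε hε1 hp0 hp1 hST U).trans_eq ?_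
  simp

/-- Sum over large sets of an exponential weight that beats the number of such sets. -/
lemma sum_exp_neg_card_le (n : ℕ) {ε : ℝ} (hε : 0 < ε) :
    ∑ S : Finset (Fin n) with ε * n ≤ S.card, Real.exp (-(Real.log ε⁻¹ + 2) * S.card)
      ≤ Real.exp (-(ε / 2 * n)) := by
  have hterm : ∀ S ∈ Finset.univ.filter fun S : Finset (Fin n) => ε * n ≤ S.card,
      Real.exp (-(Real.log ε⁻¹ + 2) * S.card)
        ≤ Real.exp (-(ε * n)) * (ε / 2) ^ S.card := fun S hS => by
    have hbase : Real.exp (-(Real.log ε⁻¹ + 2)) ≤ Real.exp (-1) * (ε / 2) := by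
      rw [Real.log_inv, show -(-Real.log ε + 2) = -1 + (Real.log ε + -1) by ring, Real.exp_add,
        Real.exp_add, Real.exp_log hε]
      have : Real.exp (-1) ≤ 1 / 2 := by linarith [Real.exp_neg_one_lt_half]
      gcongr
      nlinarith
    calc Real.exp (-(Real.log ε⁻¹ + 2) * S.card)
        = Real.exp (-(Real.log ε⁻¹ + 2)) ^ S.card := by rw [← Real.exp_nat_mul]; ring_nf
      _ ≤ (Real.exp (-1) * (ε / 2)) ^ S.card := by gcongr
      _ = Real.exp (-S.card) * (ε / 2) ^ S.card := by
          rw [mul_pow, ← Real.exp_nat_mul]; ring_nf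
      _ ≤ _ := by
          gcongr
          exact (Finset.mem_filter.1 hS).2
  calc _ ≤ ∑ S : Finset (Fin n) with ε * n ≤ S.card, Real.exp (-(ε * n)) * (ε / 2) ^ S.card :=
        Finset.sum_le_sum hterm
    _ ≤ ∑ S : Finset (Fin n), Real.exp (-(ε * n)) * (ε / 2) ^ S.card :=
        Finset.sum_le_sum_of_subset_of_nonneg (Finset.filter_subset _ _)
          fun S _ _ => by positivity
    _ = Real.exp (-(ε * n)) * (ε / 2 + 1) ^ n := by
        rw [← Finset.mul_sum, ← Fin.sum_pow_mul_eq_add_pow]; simp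
    _ ≤ Real.exp (-(ε * n)) * Real.exp (ε / 2) ^ n := by
        gcongr
        exact Real.add_one_le_exp _
    _ = Real.exp (-(ε / 2 * n)) := by
        rw [← Real.exp_nat_mul, ← Real.exp_add]; ring_nf

/-- Union bound: some large `S` has `k` deviant vertices outside it only with exponentially small
probability. -/
lemma measureReal_exists_deviant_le (n k : ℕ) {ε p : ℝ} (hε : 0 < ε) (hp : ε ≤ p) (hp1 : p ≤ 1)
    (hk : 4 * ε⁻¹ ^ 3 * (Real.log ε⁻¹ + 2) ≤ k) :
    (erMeasure n p).real {ω | ∃ S : Finset (Fin n), ε * n ≤ S.card ∧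
        ∃ T : Finset (Fin n), T.card = k ∧ Disjoint T S ∧ ∀ v ∈ T, IsDeviant ε p ω S v}
      ≤ (2 * n) ^ k * Real.exp (-(ε / 2 * n)) := by
  classical
  have hp0 : 0 < p := hε.trans_le hp
  have hrate : Real.log ε⁻¹ + 2 ≤ k * (ε ^ 2 * p / 4) := by
    calc Real.log ε⁻¹ + 2 = 4 * ε⁻¹ ^ 3 * (Real.log ε⁻¹ + 2) * (ε ^ 2 * ε / 4) := by
          field_simp
      _ ≤ _ := by gcongr
  have hsub : {ω | ∃ S : Finset (Fin n), ε * n ≤ S.card ∧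
        ∃ T : Finset (Fin n), T.card = k ∧ Disjoint T S ∧ ∀ v ∈ T, IsDeviant ε p ω S v}
      ⊆ ⋃ S ∈ Finset.univ.filter fun S : Finset (Fin n) => ε * n ≤ S.card,
        ⋃ T ∈ (Finset.powersetCard k Finset.univ).filter fun T => Disjoint T S,
          {ω | ∀ v ∈ T, IsDeviant ε p ω S v} := by
    rintro ω ⟨S, hS, T, hT, hST, h⟩
    simp only [Set.mem_iUnion]
    exact ⟨S, by simpa using hS, T, by simp [hT, hST], h⟩
  have hS : ∀ S : Finset (Fin n),
      (erMeasure n p).real (⋃ T ∈ (Finset.powersetCard k Finset.univ).filter fun T => Disjoint T S,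
          {ω | ∀ v ∈ T, IsDeviant ε p ω S v})
        ≤ (2 * n) ^ k * Real.exp (-(Real.log ε⁻¹ + 2) * S.card) := fun S => by
    have hT : ∀ T ∈ (Finset.powersetCard k Finset.univ).filter fun T => Disjoint T S,
        (erMeasure n p).real {ω | ∀ v ∈ T, IsDeviant ε p ω S v}
          ≤ 2 ^ k * Real.exp (-(Real.log ε⁻¹ + 2) * S.card) := fun T hT => by
      obtain ⟨hcard, hdisj⟩ := Finset.mem_filter.1 hT
      rw [Finset.mem_powersetCard_univ] at hcard
      refine (measureReal_all_deviant_le hε.le (hp.trans hp1) hp0.le hp1 hdisj).trans ?_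
      rw [hcard]
      gcongr
    refine (measureReal_biUnion_finset_le _ _).trans ((Finset.sum_le_card_nsmul _ _ _ hT).trans ?_)
    rw [nsmul_eq_mul, mul_pow, mul_comm ((2 : ℝ) ^ k) ((n : ℝ) ^ k), mul_assoc]
    gcongr
    have hcard := (Finset.card_filter_le (Finset.powersetCard k Finset.univ)
      fun T : Finset (Fin n) => Disjoint T S).trans_eq (Finset.card_powersetCard _ _)
    rw [Finset.card_univ, Fintype.card_fin] at hcard
    exact_mod_cast hcard.trans (Nat.choose_le_pow n k)
  refine (measureReal_mono hsub (measure_ne_top _ _)).trans ((measureReal_biUnion_finset_le _ _).trans ?_)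
  refine (Finset.sum_le_sum fun S _ => hS S).trans ?_
  rw [← Finset.mul_sum]
  gcongr
  exact sum_exp_neg_card_le n hε

lemma tendsto_pow_mul_exp_neg_mul {a : ℝ} (ha : 0 < a) (k : ℕ) :
    Tendsto (fun n : ℕ => (2 * (n : ℝ)) ^ k * Real.exp (-(a * n))) atTop (nhds 0) := by
  have hlin : Tendsto (fun n : ℕ => a * (n : ℝ)) atTop atTop :=
    tendsto_natCast_atTop_atTop.const_mul_atTop ha
  have h := ((Real.tendsto_pow_mul_exp_neg_atTop_nhds_zero k).comp hlin).const_mul ((2 / a) ^ k)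
  rw [mul_zero] at h
  refine h.congr fun n => ?_
  rw [Function.comp_apply, ← mul_assoc, ← mul_pow]
  congr 2
  field_simp

/-- **Edge-distribution lemma for random graphs.**
Let `ε > 0`. The Erdős–Rényi random graph `G(n, p)` with `p ≥ ε` has, with
probability tending to `1` as `n → ∞`, the following property: for every set
`S ⊆ V` of size `|S| ≥ εn` there is a set `X_S ⊆ V \ S` of size at most
`4ε⁻³(ln ε⁻¹ + 2)` such that every `v ∈ (V \ S) \ X_S` satisfies
`| |N(v) ∩ S| − p|S| | ≤ ε p |S|`. -/
theorem edge_distribution (ε : ℝ) (hε : 0 < ε) (p : ℝ) (hp : ε ≤ p) (hp1 : p ≤ 1) :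
    Tendsto
      (fun n : ℕ =>
        erMeasure n p
          {ω | ∀ S : Finset (Fin n), ε * n ≤ S.card →
            ∃ X : Finset (Fin n), Disjoint X S ∧
              (X.card : ℝ) ≤ 4 * ε⁻¹ ^ 3 * (Real.log ε⁻¹ + 2) ∧
              ∀ v : Fin n, v ∉ S → v ∉ X →
                |(((erGraph n ω).neighborSet v ∩ ↑S).ncard : ℝ) - p * S.card|
                  ≤ ε * (p * S.card)})
      atTop (nhds (1 : ENNReal)) := by
  classical
  set K : ℝ := 4 * ε⁻¹ ^ 3 * (Real.log ε⁻¹ + 2)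
  set k : ℕ := ⌊K⌋₊ + 1
  have hKk : K < k := by exact_mod_cast Nat.lt_floor_add_one K
  have hK0 : 0 ≤ K := by
    have : 0 ≤ Real.log ε⁻¹ := Real.log_nonneg (one_le_inv_iff₀.2 ⟨hε, hp.trans hp1⟩)
    positivity
  set bad : ∀ n : ℕ, Set (Fin n → Fin n → Bool) := fun n =>
    {ω | ∃ S : Finset (Fin n), ε * n ≤ S.card ∧
      ∃ T : Finset (Fin n), T.card = k ∧ Disjoint T S ∧ ∀ v ∈ T, IsDeviant ε p ω S v}
  have hbad : Tendsto (fun n => erMeasure n p (bad n)) atTop (nhds 0) := by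
    rw [← ENNReal.tendsto_toReal_iff (fun n => measure_ne_top _ _) ENNReal.zero_ne_top]
    exact squeeze_zero (fun n => ENNReal.toReal_nonneg)
      (fun n => measureReal_exists_deviant_le n k hε hp hp1 hKk.le)
      (tendsto_pow_mul_exp_neg_mul (half_pos hε) k)
  have hgood : Tendsto (fun n => erMeasure n p (bad n)ᶜ) atTop (nhds 1) := by
    simp_rw [fun n => prob_compl_eq_one_sub (μ := erMeasure n p) (bad n).toFinite.measurableSet]
    simpa using ENNReal.Tendsto.sub tendsto_const_nhds hbad (.inl ENNReal.one_ne_top)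
  refine tendsto_of_tendsto_of_tendsto_of_le_of_le hgood tendsto_const_nhds
    (fun n => measure_mono fun ω hω S hS => ?_) (fun n => prob_le_one)
  refine ⟨Finset.univ.filter fun v => v ∉ S ∧ IsDeviant ε p ω S v, ?_, ?_, fun v hvS hvX => ?_⟩
  · exact Finset.disjoint_left.2 fun v hv => (Finset.mem_filter.1 hv).2.1
  · by_contra hlarge
    have hcard : k ≤ (Finset.univ.filter fun v => v ∉ S ∧ IsDeviant ε p ω S v).card :=
      (Nat.floor_lt hK0).2 (not_le.1 hlarge)
    obtain ⟨T, hTsub, hT⟩ := Finset.exists_subset_card_eq hcard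
    exact hω ⟨S, hS, T, hT,
      Finset.disjoint_left.2 fun v hv => (Finset.mem_filter.1 (hTsub hv)).2.1,
      fun v hv => (Finset.mem_filter.1 (hTsub hv)).2.2⟩
  · by_contra h
    exact hvX (Finset.mem_filter.2 ⟨Finset.mem_univ v, hvS, not_le.1 h⟩)

end ErdosRenyi
end

section
/- Consider the random graph G = G_n with E₁ = I and E₀ = O, and assume 0 < ε₂ < (1/2−δ)/(1+2δ). Then for every ε' with 0 < ε' < ε₂, with probability tending to 1 as n → ∞, every vertex v ∈ P satisfies Δ(v) ≤ −ε'·|I|; in particular, with probability tending to 1, Δ(v) < 0 for all v ∈ P. -/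
open MeasureTheory Filter

namespace AdversarialOpinion

/-! ### Block structure on `Fin n`

The vertex set `Fin n` is split into five consecutive blocks
`I, J, O, P, D` of sizes `nI, nJ, nO, nP` and `n - (nI+nJ+nO+nP)`. -/

/-- `v` lies in the block `I`. -/
abbrev InI (nI : ℕ) {n : ℕ} (v : Fin n) : Prop := (v : ℕ) < nI

/-- `v` lies in the block `J`. -/
abbrev InJ (nI nJ : ℕ) {n : ℕ} (v : Fin n) : Prop :=
  nI ≤ (v : ℕ) ∧ (v : ℕ) < nI + nJ

/-- `v` lies in the block `O`. -/
abbrev InO (nI nJ nO : ℕ) {n : ℕ} (v : Fin n) : Prop :=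
  nI + nJ ≤ (v : ℕ) ∧ (v : ℕ) < nI + nJ + nO

/-- `v` lies in the block `P`. -/
abbrev InP (nI nJ nO nP : ℕ) {n : ℕ} (v : Fin n) : Prop :=
  nI + nJ + nO ≤ (v : ℕ) ∧ (v : ℕ) < nI + nJ + nO + nP

/-- `v` lies in the block `D`. -/
abbrev InD (nI nJ nO nP : ℕ) {n : ℕ} (v : Fin n) : Prop :=
  nI + nJ + nO + nP ≤ (v : ℕ)

/-- The block `I` as a finite set. -/
def Iset (nI : ℕ) (n : ℕ) : Finset (Fin n) := Finset.univ.filter fun v => InI nI v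

/-- The block `J` as a finite set. -/
def Jset (nI nJ : ℕ) (n : ℕ) : Finset (Fin n) := Finset.univ.filter fun v => InJ nI nJ v

/-- The block `O` as a finite set. -/
def Oset (nI nJ nO : ℕ) (n : ℕ) : Finset (Fin n) := Finset.univ.filter fun v => InO nI nJ nO v

/-- The block `P` as a finite set. -/
def Pset (nI nJ nO nP : ℕ) (n : ℕ) : Finset (Fin n) :=
  Finset.univ.filter fun v => InP nI nJ nO nP v

/-- The block `D` as a finite set. -/
def Dset (nI nJ nO nP : ℕ) (n : ℕ) : Finset (Fin n) :=
  Finset.univ.filter fun v => InD nI nJ nO nP v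

/-! ### The random graph `G` -/

/-- Unsymmetrized adjacency: `I`, `J`, `P` are cliques, `O` is joined to all of
`V \ D`, the pairs `I–J`, `J–P`, `I–P` are joined according to the random bits
`ω`, and the `k`-th vertex of `D` is matched to the `k`-th vertex of `J`. -/
def Rel (nI nJ nO nP : ℕ) {n : ℕ} (ω : Fin n → Fin n → Bool) (v w : Fin n) : Prop :=
  (InI nI v ∧ InI nI w) ∨
  (InJ nI nJ v ∧ InJ nI nJ w) ∨
  (InP nI nJ nO nP v ∧ InP nI nJ nO nP w) ∨
  (InO nI nJ nO v ∧ ¬ InD nI nJ nO nP w) ∨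
  (((InI nI v ∧ InJ nI nJ w) ∨ (InJ nI nJ v ∧ InP nI nJ nO nP w) ∨
      (InI nI v ∧ InP nI nJ nO nP w)) ∧ (if v ≤ w then ω v w else ω w v) = true) ∨
  (InD nI nJ nO nP v ∧ InJ nI nJ w ∧ (w : ℕ) = nI + ((v : ℕ) - (nI + nJ + nO + nP)))

/-- The (random) graph `G` determined by the family of independent random bits `ω`. -/
def blockGraph (nI nJ nO nP : ℕ) {n : ℕ} (ω : Fin n → Fin n → Bool) :
    SimpleGraph (Fin n) where
  Adj v w := v ≠ w ∧ (Rel nI nJ nO nP ω v w ∨ Rel nI nJ nO nP ω w v)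
  symm := ⟨fun _ _ h => ⟨h.1.symm, h.2.symm⟩⟩
  loopless := ⟨fun _ h => h.1 rfl⟩

/-! ### Probability measures -/

/-- Bernoulli measure on `Bool` with success probability `p` (clamped to `[0,1]`). -/
noncomputable def bern (p : ℝ) : Measure Bool :=
  (PMF.bernoulli (min (Real.toNNReal p) 1) (min_le_right _ _)).toMeasure

instance (p : ℝ) : IsProbabilityMeasure (bern p) := by
  unfold bern; infer_instance

/-- The success probability of the random bit attached to the (ordered) pair
`(v, w)`: `p_IJ = p_JP = (1/2−δ)/(1/2+δ) + ε₁` for pairs in `I×J` and `J×P`,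
and `p_IP = (1/2−δ)/(1/2+δ) − ε₂` for pairs in `I×P` (all other bits are unused). -/
noncomputable def edgeProb (nI nJ nO nP : ℕ) (δ ε₁ ε₂ : ℝ) {n : ℕ} (v w : Fin n) : ℝ :=
  if InI nI v ∧ InJ nI nJ w then (1 / 2 - δ) / (1 / 2 + δ) + ε₁
  else if InJ nI nJ v ∧ InP nI nJ nO nP w then (1 / 2 - δ) / (1 / 2 + δ) + ε₁
  else if InI nI v ∧ InP nI nJ nO nP w then (1 / 2 - δ) / (1 / 2 + δ) - ε₂
  else 0

/-- The distribution of the random bits defining the graph `G`: all bits are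
independent, and the bit of a pair in `I×J`, `J×P`, `I×P` is Bernoulli with
parameter `p_IJ`, `p_JP`, `p_IP` respectively. -/
noncomputable def edgeMeasure (n nI nJ nO nP : ℕ) (δ ε₁ ε₂ : ℝ) :
    Measure (Fin n → Fin n → Bool) :=
  Measure.pi fun v => Measure.pi fun w => bern (edgeProb nI nJ nO nP δ ε₁ ε₂ v w)

/-- Independent fair coins, one for each vertex (used for random tie-breaking in
the non-iterative dissemination). -/
noncomputable def coinMeasure (n : ℕ) : Measure (Fin n → Bool) :=
  Measure.pi fun _ => bern (1 / 2)

/-- Independent fair coins, one for each round and each vertex (used for random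
tie-breaking in the iterative dissemination). -/
noncomputable def tieMeasure (n : ℕ) : Measure (Fin n → Fin n → Bool) :=
  Measure.pi fun _ => Measure.pi fun _ => bern (1 / 2)

/-! ### The dissemination processes -/

/-- `Δ(v) = |N(v) ∩ E₁| − |N(v) ∩ E₀|`. -/
noncomputable def Delta {n : ℕ} (H : SimpleGraph (Fin n)) (E₁ E₀ : Finset (Fin n))
    (v : Fin n) : ℤ :=
  ((H.neighborSet v ∩ ↑E₁).ncard : ℤ) - ((H.neighborSet v ∩ ↑E₀).ncard : ℤ)

/-- The non-iterative dissemination: experts keep their label; every other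
vertex takes the majority label among its expert neighbours, ties (in
particular, vertices with no expert neighbour) being broken by the coin `c`. -/
noncomputable def labelNonIter {n : ℕ} (H : SimpleGraph (Fin n)) (E₁ E₀ : Finset (Fin n))
    (c : Fin n → Bool) (v : Fin n) : Bool :=
  if v ∈ E₁ then true
  else if v ∈ E₀ then false
  else if 0 < Delta H E₁ E₀ v then true
  else if Delta H E₁ E₀ v < 0 then false
  else c v

/-- One round of the iterative dissemination: an unlabeled vertex gets label
`1` (resp. `0`) if it has strictly more (resp. fewer) `1`-labeled than
`0`-labeled neighbours; a tie involving at least one labeled neighbour is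
broken by the coin; a vertex with no labeled neighbour stays unlabeled. -/
noncomputable def iterStep {n : ℕ} (H : SimpleGraph (Fin n)) (coin : Fin n → Bool)
    (prev : Fin n → Option Bool) (v : Fin n) : Option Bool :=
  match prev v with
  | some b => some b
  | none =>
    let a := (H.neighborSet v ∩ {w | prev w = some true}).ncard
    let z := (H.neighborSet v ∩ {w | prev w = some false}).ncard
    if z < a then some true
    else if a < z then some false
    else if a = 0 then none
    else some (coin v)

/-- The state of the iterative dissemination after `t` rounds, starting from
the expert labeling given by `E₁, E₀` and using the tie-breaking coins `tb`. -/
noncomputable def iterLabel {n : ℕ} (H : SimpleGraph (Fin n)) (E₁ E₀ : Finset (Fin n))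
    (tb : ℕ → Fin n → Bool) : ℕ → Fin n → Option Bool
  | 0 => fun v => if v ∈ E₁ then some true else if v ∈ E₀ then some false else none
  | t + 1 => iterStep H (tb t) (iterLabel H E₁ E₀ tb t)

/-- Reading off per-round tie-breaking coins from a `Fin n`-indexed family.
Since in every round the set of labeled vertices only grows, the iterative
process stabilizes after at most `n` rounds, so `n` rounds of coins suffice. -/
def tieOf {n : ℕ} (T : Fin n → Fin n → Bool) (t : ℕ) : Fin n → Bool :=
  if h : t < n then T ⟨t, h⟩ else fun _ => true

/-! ### Robustness -/

/-- `sI, sJ, sO, sP, sD` are admissible block sizes for `n` vertices: they have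
the prescribed cardinalities (all of which are integers), and `|D| ≤ |J|` so
that the matching from `D` into `J` exists. -/
def AdmissibleSizes (μ δ d : ℝ) (sI sJ sO sP sD : ℕ → ℕ) (n : ℕ) : Prop :=
  sI n + sJ n + sO n + sP n + sD n = n ∧ sD n ≤ sJ n ∧
  ((sI n : ℝ)) = μ * (1 / 2 + δ) * n ∧
  ((sO n : ℝ)) = μ * (1 / 2 - δ) * n ∧
  ((sI n : ℝ)) + ((sJ n : ℝ)) = (1 - d) * n / 2 ∧
  ((sO n : ℝ)) + ((sP n : ℝ)) = (1 - d) * n / 2 ∧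
  ((sD n : ℝ)) = d * n

/-- The event (on the randomness of the graph together with the tie-breaking
coins) that for every admissible choice of the expert sets `E₁, E₀` by the
strong adversary, more than half of all vertices are labeled `1` at the end of
the iterative dissemination. -/
def IterMajority (μ δ : ℝ) (n nI nJ nO nP : ℕ)
    (ω : (Fin n → Fin n → Bool) × (Fin n → Fin n → Bool)) : Prop :=
  ∀ E₁ E₀ : Finset (Fin n), Disjoint E₁ E₀ →
    ((E₁.card : ℝ)) = (1 / 2 + δ) * μ * n →
    ((E₀.card : ℝ)) = (1 / 2 - δ) * μ * n →
    n < 2 * ({v : Fin n |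
      iterLabel (blockGraph nI nJ nO nP ω.1) E₁ E₀ (tieOf ω.2) n v = some true}.ncard)

/-- The event (on the randomness of the graph together with the tie-breaking
coins) that for every admissible choice of the expert sets `E₁, E₀` by the
strong adversary, more than half of all vertices are labeled `1` at the end of
the non-iterative dissemination. -/
def NonIterMajority (μ δ : ℝ) (n nI nJ nO nP : ℕ)
    (ω : (Fin n → Fin n → Bool) × (Fin n → Bool)) : Prop :=
  ∀ E₁ E₀ : Finset (Fin n), Disjoint E₁ E₀ →
    ((E₁.card : ℝ)) = (1 / 2 + δ) * μ * n →
    ((E₀.card : ℝ)) = (1 / 2 - δ) * μ * n →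
    n < 2 * ({v : Fin n |
      labelNonIter (blockGraph nI nJ nO nP ω.1) E₁ E₀ ω.2 v = true}.ncard)

/-- The graph sequence `G = G_n` (with block sizes `sI, …, sD`) is robust
against the iterative strong adversary: with probability tending to `1` as
`n → ∞` (along the admissible `n`), for every choice of the expert sets, more
than half of all vertices are labeled `1` after the iterative dissemination. -/
def RobustIter (μ δ ε₁ ε₂ d : ℝ) (sI sJ sO sP sD : ℕ → ℕ) : Prop :=
  Tendsto
    (fun n : ℕ =>
      ((edgeMeasure n (sI n) (sJ n) (sO n) (sP n) δ ε₁ ε₂).prod (tieMeasure n))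
        {ω | IterMajority μ δ n (sI n) (sJ n) (sO n) (sP n) ω})
    (atTop ⊓ 𝓟 {n | AdmissibleSizes μ δ d sI sJ sO sP sD n}) (nhds 1)

/-- The graph sequence `G = G_n` (with block sizes `sI, …, sD`) is robust
against the non-iterative strong adversary: with probability tending to `1` as
`n → ∞` (along the admissible `n`), for every choice of the expert sets, more
than half of all vertices are labeled `1` after the non-iterative dissemination. -/
def RobustNonIter (μ δ ε₁ ε₂ d : ℝ) (sI sJ sO sP sD : ℕ → ℕ) : Prop :=
  Tendsto
    (fun n : ℕ =>
      ((edgeMeasure n (sI n) (sJ n) (sO n) (sP n) δ ε₁ ε₂).prod (coinMeasure n))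
        {ω | NonIterMajority μ δ n (sI n) (sJ n) (sO n) (sP n) ω})
    (atTop ⊓ 𝓟 {n | AdmissibleSizes μ δ d sI sJ sO sP sD n}) (nhds 1)


theorem integral_bern {p : ℝ} (h0 : 0 ≤ p) (h1 : p ≤ 1) :
    ∫ b, (if b = true then (1 : ℝ) else 0) ∂(bern p) = p := by
  have h : min (Real.toNNReal p) 1 = Real.toNNReal p := by
    rw [min_eq_left_iff, Real.toNNReal_le_one]; exact h1
  simp [bern, PMF.integral_eq_sum, PMF.bernoulli_apply, h, h0]

/-- Hoeffding's inequality for the number of successes within a column of an array of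
independent Bernoulli bits. -/
theorem column_upper_tail {n : ℕ} (q : Fin n → Fin n → ℝ) (s : Finset (Fin n)) (v : Fin n)
    {p t : ℝ} (h0 : 0 ≤ p) (h1 : p ≤ 1) (ht : 0 ≤ t) (hq : ∀ w ∈ s, q w v = p) :
    (Measure.pi fun a => Measure.pi fun b => bern (q a b)).real
        {ω : Fin n → Fin n → Bool |
          (p + t) * (s.card : ℝ) ≤ ((s.filter fun w => ω w v = true).card : ℝ)} ≤
      Real.exp (-2 * t ^ 2 * s.card) := by
  set M : Measure (Fin n → Fin n → Bool) :=
    Measure.pi fun a => Measure.pi fun b => bern (q a b) with hM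
  let f : (Fin n → Bool) → ℝ := fun x => if x v = true then 1 else 0
  have hf : Measurable f :=
    (measurable_of_finite fun b : Bool => if b = true then (1 : ℝ) else 0).comp
      (measurable_pi_apply v)
  have hmean : ∀ w ∈ s, ∫ ω, f (ω w) ∂M = p := by
    intro w hw
    calc ∫ ω, f (ω w) ∂M = ∫ x, f x ∂(Measure.pi fun b => bern (q w b)) :=
          integral_comp_eval (μ := fun a => Measure.pi fun b => bern (q a b))
            hf.aestronglyMeasurable
      _ = ∫ b, (if b = true then (1 : ℝ) else 0) ∂(bern (q w v)) :=
          integral_comp_eval (μ := fun b => bern (q w b))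
            (f := fun b : Bool => if b = true then (1 : ℝ) else 0)
            (measurable_of_finite _).aestronglyMeasurable
      _ = p := by rw [hq w hw, integral_bern h0 h1]
  have hindep : ProbabilityTheory.iIndepFun
      (fun (w : Fin n) (ω : Fin n → Fin n → Bool) => f (ω w) - p) M :=
    ProbabilityTheory.iIndepFun_pi (X := fun _ x => f x - p)
      fun _ => (hf.sub_const p).aemeasurable
  have hsub : ∀ w ∈ s, ProbabilityTheory.HasSubgaussianMGF
      (fun ω : Fin n → Fin n → Bool => f (ω w) - p) ((‖(1 : ℝ) - 0‖₊ / 2) ^ 2) M := by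
    intro w hw
    have h := ProbabilityTheory.hasSubgaussianMGF_of_mem_Icc (μ := M) (a := 0) (b := 1)
      (X := fun ω : Fin n → Fin n → Bool => f (ω w))
      (hf.comp (measurable_pi_apply w)).aemeasurable
      (Eventually.of_forall fun ω => by
        by_cases h : ω w v = true <;> simp [f, h])
    rwa [hmean w hw] at h
  have hmain := ProbabilityTheory.HasSubgaussianMGF.measure_sum_ge_le_of_iIndepFun hindep hsub
    (ε := t * s.card) (by positivity)
  have hset : {ω : Fin n → Fin n → Bool |
        (p + t) * (s.card : ℝ) ≤ ((s.filter fun w => ω w v = true).card : ℝ)} =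
      {ω | t * (s.card : ℝ) ≤ ∑ w ∈ s, (f (ω w) - p)} := by
    ext ω
    have : ∑ w ∈ s, (f (ω w) - p) =
        ((s.filter fun w => ω w v = true).card : ℝ) - p * s.card := by
      simp [f, Finset.sum_sub_distrib, mul_comm]
    rw [Set.mem_ofPred_eq, Set.mem_ofPred_eq, this, le_sub_iff_add_le, add_mul, add_comm]
  rw [hset]
  refine hmain.trans (Real.exp_le_exp.2 (le_of_eq ?_))
  rcases eq_or_ne (s.card : ℝ) 0 with hs | hs
  · simp [hs]
  · simp
    field_simp

theorem card_Iset {nI n : ℕ} (h : nI ≤ n) : (Iset nI n).card = nI := by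
  rw [Iset, Fin.card_filter_val_lt, min_eq_right h]

theorem card_Oset {nI nJ nO n : ℕ} (h : nI + nJ + nO ≤ n) :
    (Oset nI nJ nO n).card = nO := by
  have : (Oset nI nJ nO n).map Fin.valEmbedding = Finset.Ico (nI + nJ) (nI + nJ + nO) := by
    ext a
    simp only [Oset, Finset.mem_map, Finset.mem_filter, Finset.mem_univ, true_and,
      Fin.valEmbedding_apply, Finset.mem_Ico]
    exact ⟨by rintro ⟨x, hx, rfl⟩; exact hx, fun ha => ⟨⟨a, by lia⟩, ha, rfl⟩⟩
  rw [← Finset.card_map Fin.valEmbedding, this, Nat.card_Ico]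
  lia

theorem Delta_blockGraph_of_InP {n nI nJ nO nP : ℕ} (ω : Fin n → Fin n → Bool) {v : Fin n}
    (hn : nI + nJ + nO ≤ n) (hv : InP nI nJ nO nP v) :
    Delta (blockGraph nI nJ nO nP ω) (Iset nI n) (Oset nI nJ nO n) v =
      (((Iset nI n).filter fun w => ω w v = true).card : ℤ) - nO := by
  have hI : (blockGraph nI nJ nO nP ω).neighborSet v ∩ ↑(Iset nI n) =
      ↑((Iset nI n).filter fun w => ω w v = true) := by
    ext w
    simp only [blockGraph, Rel, Iset, Set.mem_inter_iff, SimpleGraph.mem_neighborSet,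
      Finset.coe_filter, Finset.mem_filter, Finset.mem_univ, true_and, Set.mem_ofPred_eq]
    rw [and_comm]
    refine and_congr_right fun hw => ?_
    have hle : w ≤ v := by rw [Fin.le_def]; lia
    have hne : v ≠ w := by rintro rfl; lia
    rw [if_pos hle]
    grind
  have hO : (blockGraph nI nJ nO nP ω).neighborSet v ∩ ↑(Oset nI nJ nO n) =
      ↑(Oset nI nJ nO n) := by
    refine Set.inter_eq_right.2 fun w hw => ?_
    simp only [Oset, Finset.coe_filter, Finset.mem_univ, true_and, Set.mem_ofPred_eq] at hw
    refine ⟨by rintro rfl; lia, Or.inr (Or.inr (Or.inr (Or.inr (Or.inl ⟨hw, ?_⟩))))⟩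
    lia
  rw [Delta, hI, hO, Set.ncard_coe_finset, Set.ncard_coe_finset, card_Oset hn]

instance (n nI nJ nO nP : ℕ) (δ ε₁ ε₂ : ℝ) :
    IsProbabilityMeasure (edgeMeasure n nI nJ nO nP δ ε₁ ε₂) := by
  unfold edgeMeasure; infer_instance

/-- Union bound over `P` for the probability that some `v ∈ P` has `Δ(v) > -ε' |I|`. -/
theorem one_sub_le_edgeMeasure_Delta_le {n nI nJ nO nP : ℕ} {δ ε₁ ε₂ ε' : ℝ}
    (hδ0 : 0 < δ) (hδ1 : δ < 1 / 2) (hε₂0 : 0 < ε₂)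
    (hpIP : 0 ≤ (1 / 2 - δ) / (1 / 2 + δ) - ε₂) (hε'1 : ε' < ε₂)
    (hn : nI + nJ + nO ≤ n) (hO : (nO : ℝ) = (1 / 2 - δ) / (1 / 2 + δ) * nI) :
    1 - ENNReal.ofReal (n * Real.exp (-2 * (ε₂ - ε') ^ 2 * nI)) ≤
      edgeMeasure n nI nJ nO nP δ ε₁ ε₂
        {ω | ∀ v : Fin n, InP nI nJ nO nP v →
          (Delta (blockGraph nI nJ nO nP ω) (Iset nI n) (Oset nI nJ nO n) v : ℝ) ≤
            -ε' * ((Iset nI n).card : ℝ)} := by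
  set A := {ω : Fin n → Fin n → Bool | ∀ v : Fin n, InP nI nJ nO nP v →
    (Delta (blockGraph nI nJ nO nP ω) (Iset nI n) (Oset nI nJ nO n) v : ℝ) ≤
      -ε' * ((Iset nI n).card : ℝ)} with hA
  set M := edgeMeasure n nI nJ nO nP δ ε₁ ε₂
  set p := (1 / 2 - δ) / (1 / 2 + δ) - ε₂ with hp
  have hp1 : p ≤ 1 := by
    have : (1 / 2 - δ) / (1 / 2 + δ) ≤ 1 := by rw [div_le_one (by linarith)]; linarith
    linarith
  have hcard := card_Iset (show nI ≤ n by lia)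
  let B : Fin n → Set (Fin n → Fin n → Bool) := fun v =>
    {ω | (p + (ε₂ - ε')) * ((Iset nI n).card : ℝ) ≤
      (((Iset nI n).filter fun w => ω w v = true).card : ℝ)}
  have hsub : Aᶜ ⊆ ⋃ v ∈ Pset nI nJ nO nP n, B v := by
    intro ω hω
    simp only [hA, Set.mem_compl_iff, Set.mem_ofPred_eq, not_forall, not_le] at hω
    obtain ⟨v, hv, hlt⟩ := hω
    rw [Delta_blockGraph_of_InP ω hn hv] at hlt
    push_cast at hlt
    refine Set.mem_biUnion (x := v) (by simpa [Pset] using hv) ?_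
    simp only [B, Set.mem_ofPred_eq]
    rw [hcard] at hlt ⊢
    rw [hO] at hlt
    rw [hp]
    linarith
  have hB : ∀ v ∈ Pset nI nJ nO nP n, M.real (B v) ≤ Real.exp (-2 * (ε₂ - ε') ^ 2 * nI) := by
    intro v hv
    replace hv : InP nI nJ nO nP v := by simpa [Pset] using hv
    have h := column_upper_tail (edgeProb nI nJ nO nP δ ε₁ ε₂ (n := n)) (Iset nI n) v
      hpIP hp1 (sub_nonneg.2 hε'1.le) (by
        intro w hw
        replace hw : (w : ℕ) < nI := by simpa [Iset] using hw
        rw [edgeProb, if_neg (by lia), if_neg (by lia), if_pos ⟨hw, hv⟩])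
    refine h.trans_eq ?_
    rw [hcard]
  have hcompl : M Aᶜ ≤ ENNReal.ofReal (n * Real.exp (-2 * (ε₂ - ε') ^ 2 * nI)) := by
    rw [← ofReal_measureReal]
    refine ENNReal.ofReal_le_ofReal ?_
    calc M.real Aᶜ ≤ M.real (⋃ v ∈ Pset nI nJ nO nP n, B v) :=
          measureReal_mono hsub (measure_ne_top M _)
      _ ≤ ∑ v ∈ Pset nI nJ nO nP n, M.real (B v) := measureReal_biUnion_finset_le _ _
      _ ≤ (Pset nI nJ nO nP n).card • Real.exp (-2 * (ε₂ - ε') ^ 2 * nI) :=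
        Finset.sum_le_card_nsmul _ _ _ hB
      _ ≤ n * Real.exp (-2 * (ε₂ - ε') ^ 2 * nI) := by
        rw [nsmul_eq_mul]
        gcongr
        exact (Finset.card_le_univ _).trans_eq (Fintype.card_fin n)
  rw [tsub_le_iff_right]
  calc (1 : ENNReal) = M (A ∪ Aᶜ) := by rw [Set.union_compl_self, measure_univ]
    _ ≤ M A + M Aᶜ := measure_union_le _ _
    _ ≤ _ := by gcongr

theorem tendsto_nat_mul_exp_neg_mul {c : ℝ} (hc : 0 < c) :
    Tendsto (fun n : ℕ => (n : ℝ) * Real.exp (-(c * n))) atTop (nhds 0) := by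
  have h := ((Real.tendsto_pow_mul_exp_neg_atTop_nhds_zero 1).comp
    ((tendsto_natCast_atTop_atTop (R := ℝ)).const_mul_atTop hc)).const_mul c⁻¹
  rw [mul_zero] at h
  refine h.congr fun n => ?_
  simp only [Function.comp_apply, pow_one]
  field_simp

/-- For the expert choice `E₁ = I`, `E₀ = O` and any `0 < ε' < ε₂` (where
`0 < ε₂ < (1/2−δ)/(1+2δ)`), with probability tending to `1` as `n → ∞`, every
vertex `v ∈ P` satisfies `Δ(v) ≤ −ε'·|I|`; in particular, with probability
tending to `1`, `Δ(v) < 0` for all `v ∈ P`. -/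
theorem delta_on_P_whp (μ δ ε₁ ε₂ d : ℝ) (hμ0 : 0 < μ) (hμ1 : μ < 1 / 2)
    (hδ0 : 0 < δ) (hδ1 : δ < 1 / 2) (hε₁0 : 0 < ε₁) (hε₂0 : 0 < ε₂) (hd0 : 0 < d)
    (hε₂1 : ε₂ < (1 / 2 - δ) / (1 + 2 * δ))
    (hpIJ : (1 / 2 - δ) / (1 / 2 + δ) + ε₁ ≤ 1)
    (hpIP : 0 ≤ (1 / 2 - δ) / (1 / 2 + δ) - ε₂)
    (ε' : ℝ) (hε'0 : 0 < ε') (hε'1 : ε' < ε₂)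
    (sI sJ sO sP sD : ℕ → ℕ)
    (hadm : {n | AdmissibleSizes μ δ d sI sJ sO sP sD n}.Infinite) :
    Tendsto
      (fun n : ℕ =>
        edgeMeasure n (sI n) (sJ n) (sO n) (sP n) δ ε₁ ε₂
          {ω | ∀ v : Fin n, InP (sI n) (sJ n) (sO n) (sP n) v →
            ((Delta (blockGraph (sI n) (sJ n) (sO n) (sP n) ω)
                (Iset (sI n) n) (Oset (sI n) (sJ n) (sO n) n) v : ℝ))
              ≤ -ε' * (((Iset (sI n) n).card : ℝ))})
      (atTop ⊓ 𝓟 {n | AdmissibleSizes μ δ d sI sJ sO sP sD n}) (nhds 1) ∧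
    Tendsto
      (fun n : ℕ =>
        edgeMeasure n (sI n) (sJ n) (sO n) (sP n) δ ε₁ ε₂
          {ω | ∀ v : Fin n, InP (sI n) (sJ n) (sO n) (sP n) v →
            Delta (blockGraph (sI n) (sJ n) (sO n) (sP n) ω)
                (Iset (sI n) n) (Oset (sI n) (sJ n) (sO n) n) v < 0})
      (atTop ⊓ 𝓟 {n | AdmissibleSizes μ δ d sI sJ sO sP sD n}) (nhds 1) := by
  have hfirst : Tendsto
      (fun n : ℕ =>
        edgeMeasure n (sI n) (sJ n) (sO n) (sP n) δ ε₁ ε₂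
          {ω | ∀ v : Fin n, InP (sI n) (sJ n) (sO n) (sP n) v →
            ((Delta (blockGraph (sI n) (sJ n) (sO n) (sP n) ω)
                (Iset (sI n) n) (Oset (sI n) (sJ n) (sO n) n) v : ℝ))
              ≤ -ε' * (((Iset (sI n) n).card : ℝ))})
      (atTop ⊓ 𝓟 {n | AdmissibleSizes μ δ d sI sJ sO sP sD n}) (nhds 1) := by
    have hc : 0 < 2 * (ε₂ - ε') ^ 2 * (μ * (1 / 2 + δ)) := by
      have := sub_pos.2 hε'1
      positivity
    have hlim := ENNReal.Tendsto.sub (tendsto_const_nhds (x := (1 : ENNReal)))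
      (ENNReal.tendsto_ofReal (tendsto_nat_mul_exp_neg_mul hc)) (Or.inl ENNReal.one_ne_top)
    rw [ENNReal.ofReal_zero, tsub_zero] at hlim
    refine tendsto_of_tendsto_of_tendsto_of_le_of_le' (hlim.mono_left inf_le_left)
      tendsto_const_nhds ?_ (Eventually.of_forall fun n => ?_)
    · filter_upwards [mem_inf_of_right (mem_principal_self _)] with n hn
      obtain ⟨hsum, -, hI, hO, -⟩ := hn
      have hbound := one_sub_le_edgeMeasure_Delta_le (n := n) (nI := sI n) (nJ := sJ n)
        (nO := sO n) (nP := sP n) (ε₁ := ε₁) hδ0 hδ1 hε₂0 hpIP hε'1 (by lia) (by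
          rw [hI, hO]
          field_simp)
      refine le_trans (le_of_eq ?_) hbound
      rw [hI]
      congr 4
      ring
    · exact prob_le_one
  refine ⟨hfirst, tendsto_of_tendsto_of_tendsto_of_le_of_le' hfirst tendsto_const_nhds ?_
    (Eventually.of_forall fun n => ?_)⟩
  · filter_upwards [mem_inf_of_right (mem_principal_self _),
      mem_inf_of_left (eventually_gt_atTop 0)] with n hn hpos
    obtain ⟨hsum, -, hI, -⟩ := hn
    refine measure_mono fun ω hω v hv => ?_
    have h := hω v hv
    rw [card_Iset (by lia), hI] at h
    have hn' : (0 : ℝ) < n := Nat.cast_pos.2 hpos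
    have : 0 < ε' * (μ * (1 / 2 + δ) * n) := by positivity
    have h' : (Delta (blockGraph (sI n) (sJ n) (sO n) (sP n) ω)
        (Iset (sI n) n) (Oset (sI n) (sJ n) (sO n) n) v : ℝ) < 0 := by linarith
    exact_mod_cast h'
  · exact prob_le_one

end AdversarialOpinion
end
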